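/- Let K be a field, A a finite-dimensional K-algebra, e an idempotent, and t ≥ 2 a natural number. Suppose that for all finite-dimensional right A-modules X, Y and all j > t there are group isomorphisms Ext^j_A(X, Y) ≅ Ext^j_{eAe}(Xe, Ye), and suppose Ae is projective as a right eAe-module. If idim_{eAe} eAe ≤ n for some n ≥ t, then idim_A A ≤ n. -/

import Mathlib

open MulOpposite

noncomputable section

variable {A : Type*} [Ring A]

/-- The corner ring `eAe` of an idempotent `e`. -/
def Corner {A : Type*} [Ring A] (e : A) (_he : IsIdempotentElem e) : Type _ :=
  {x : A // e * x * e = x}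

namespace Corner

variable {e : A} {he : IsIdempotentElem e}

lemma left_absorb (x : Corner e he) : e * x.1 = x.1 := by
  conv_lhs => rw [← x.2]
  rw [← mul_assoc, ← mul_assoc, he]
  exact x.2

lemma right_absorb (x : Corner e he) : x.1 * e = x.1 := by
  conv_lhs => rw [← x.2]
  rw [mul_assoc, he]
  exact x.2

instance : Add (Corner e he) := ⟨fun x y => ⟨x.1 + y.1, by
  have hx := x.2; have hy := y.2
  rw [mul_add, add_mul, hx, hy]⟩⟩

instance : Zero (Corner e he) := ⟨⟨0, by simp⟩⟩

instance : Neg (Corner e he) := ⟨fun x => ⟨-x.1, by have hx := x.2; rw [mul_neg, neg_mul, hx]⟩⟩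

instance : Mul (Corner e he) := ⟨fun x y => ⟨x.1 * y.1, by
  rw [mul_assoc, mul_assoc, right_absorb (he := he) y, ← mul_assoc,
    left_absorb (he := he) x]⟩⟩

instance : One (Corner e he) := ⟨⟨e, by rw [he, he]⟩⟩

instance addCommGroup : AddCommGroup (Corner e he) :=
  { add_assoc := fun x y z => Subtype.ext (add_assoc _ _ _)
    zero_add := fun x => Subtype.ext (zero_add _)
    add_zero := fun x => Subtype.ext (add_zero _)
    neg_add_cancel := fun x => Subtype.ext (neg_add_cancel _)
    add_comm := fun x y => Subtype.ext (add_comm _ _)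
    nsmul := nsmulRec
    zsmul := zsmulRec }

instance ring : Ring (Corner e he) :=
  { Corner.addCommGroup with
    mul_assoc := fun x y z => Subtype.ext (mul_assoc _ _ _)
    one_mul := fun x => Subtype.ext (left_absorb x)
    mul_one := fun x => Subtype.ext (right_absorb x)
    left_distrib := fun x y z => Subtype.ext (mul_add _ _ _)
    right_distrib := fun x y z => Subtype.ext (add_mul _ _ _)
    zero_mul := fun x => Subtype.ext (zero_mul _)
    mul_zero := fun x => Subtype.ext (mul_zero _) }

end Corner

/-- `Ae` as a right `eAe`-module (and left `A`-module). -/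
def AeSub {A : Type*} [Ring A] (e : A) : Type _ := {x : A // x * e = x}

/-- `eA` as a left `eAe`-module (and right `A`-module). -/
def EASub {A : Type*} [Ring A] (e : A) : Type _ := {x : A // e * x = x}

namespace AeSub

variable {e : A}

instance : Add (AeSub e) := ⟨fun x y => ⟨x.1 + y.1, by rw [add_mul, x.2, y.2]⟩⟩
instance : Zero (AeSub e) := ⟨⟨0, by simp⟩⟩
instance : Neg (AeSub e) := ⟨fun x => ⟨-x.1, by rw [neg_mul, x.2]⟩⟩

instance addCommGroup : AddCommGroup (AeSub e) :=
  { add_assoc := fun x y z => Subtype.ext (add_assoc _ _ _)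
    zero_add := fun x => Subtype.ext (zero_add _)
    add_zero := fun x => Subtype.ext (add_zero _)
    neg_add_cancel := fun x => Subtype.ext (neg_add_cancel _)
    add_comm := fun x y => Subtype.ext (add_comm _ _)
    nsmul := nsmulRec
    zsmul := zsmulRec }

/-- The right `eAe`-module structure on `Ae`, as a left module over the opposite ring. -/
instance module (he : IsIdempotentElem e) : Module (Corner e he)ᵐᵒᵖ (AeSub e) :=
  { smul := fun r x => ⟨x.1 * (unop r).1, by
      rw [mul_assoc, Corner.right_absorb (he := he) (unop r)]⟩
    one_smul := fun x => Subtype.ext x.2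
    mul_smul := fun r s x => Subtype.ext (by
      show x.1 * ((unop s).1 * (unop r).1) = (x.1 * (unop s).1) * (unop r).1
      rw [mul_assoc])
    smul_zero := fun r => Subtype.ext (zero_mul _)
    smul_add := fun r x y => Subtype.ext (add_mul _ _ _)
    add_smul := fun r s x => Subtype.ext (mul_add _ _ _)
    zero_smul := fun x => Subtype.ext (mul_zero _) }

/-- The left `A`-module structure on `Ae`. -/
instance : Module A (AeSub e) :=
  { smul := fun a x => ⟨a * x.1, by rw [mul_assoc, x.2]⟩
    one_smul := fun x => Subtype.ext (one_mul _)
    mul_smul := fun a b x => Subtype.ext (mul_assoc _ _ _)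
    smul_zero := fun a => Subtype.ext (mul_zero _)
    smul_add := fun a x y => Subtype.ext (mul_add _ _ _)
    add_smul := fun a b x => Subtype.ext (add_mul _ _ _)
    zero_smul := fun x => Subtype.ext (zero_mul _) }

end AeSub

namespace EASub

variable {e : A}

instance : Add (EASub e) := ⟨fun x y => ⟨x.1 + y.1, by rw [mul_add, x.2, y.2]⟩⟩
instance : Zero (EASub e) := ⟨⟨0, by simp⟩⟩
instance : Neg (EASub e) := ⟨fun x => ⟨-x.1, by rw [mul_neg, x.2]⟩⟩

instance addCommGroup : AddCommGroup (EASub e) :=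
  { add_assoc := fun x y z => Subtype.ext (add_assoc _ _ _)
    zero_add := fun x => Subtype.ext (zero_add _)
    add_zero := fun x => Subtype.ext (add_zero _)
    neg_add_cancel := fun x => Subtype.ext (neg_add_cancel _)
    add_comm := fun x y => Subtype.ext (add_comm _ _)
    nsmul := nsmulRec
    zsmul := zsmulRec }

/-- The left `eAe`-module structure on `eA`. -/
instance module (he : IsIdempotentElem e) : Module (Corner e he) (EASub e) :=
  { smul := fun r x => ⟨r.1 * x.1, by
      rw [← mul_assoc, Corner.left_absorb (he := he) r]⟩
    one_smul := fun x => Subtype.ext x.2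
    mul_smul := fun r s x => Subtype.ext (mul_assoc _ _ _)
    smul_zero := fun r => Subtype.ext (mul_zero _)
    smul_add := fun r x y => Subtype.ext (mul_add _ _ _)
    add_smul := fun r s x => Subtype.ext (add_mul _ _ _)
    zero_smul := fun x => Subtype.ext (zero_mul _) }

/-- The right `A`-module structure on `eA`, as a left module over `Aᵐᵒᵖ`. -/
instance : Module Aᵐᵒᵖ (EASub e) :=
  { smul := fun a x => ⟨x.1 * unop a, by rw [← mul_assoc, x.2]⟩
    one_smul := fun x => Subtype.ext (mul_one _)
    mul_smul := fun a b x => Subtype.ext (mul_assoc _ _ _).symm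
    smul_zero := fun a => Subtype.ext (zero_mul _)
    smul_add := fun a x y => Subtype.ext (add_mul _ _ _)
    add_smul := fun a b x => Subtype.ext (mul_add _ _ _)
    zero_smul := fun x => Subtype.ext (mul_zero _) }

end EASub

open scoped TensorProduct

/-- The subgroup of `M ⊗_ℤ N` by which one quotients to obtain the balanced tensor
product `M ⊗_R N` of a right `R`-module `M` and a left `R`-module `N`. -/
def midSpan (R : Type*) [Ring R] (M N : Type*) [AddCommGroup M] [AddCommGroup N]
    [Module Rᵐᵒᵖ M] [Module R N] : Submodule ℤ (TensorProduct ℤ M N) :=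
  Submodule.span ℤ
    {z | ∃ (r : R) (x : M) (y : N), z = (op r • x) ⊗ₜ[ℤ] y - x ⊗ₜ[ℤ] (r • y)}

/-- The balanced tensor product `M ⊗_R N` of a right `R`-module `M` and a left
`R`-module `N` over a (not necessarily commutative) ring `R`. -/
def NCTensor (R : Type*) [Ring R] (M N : Type*) [AddCommGroup M] [AddCommGroup N]
    [Module Rᵐᵒᵖ M] [Module R N] : Type _ :=
  TensorProduct ℤ M N ⧸ midSpan R M N

instance {R : Type*} [Ring R] {M N : Type*} [AddCommGroup M] [AddCommGroup N]
    [Module Rᵐᵒᵖ M] [Module R N] : AddCommGroup (NCTensor R M N) :=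
  inferInstanceAs (AddCommGroup (TensorProduct ℤ M N ⧸ midSpan R M N))

/-- The class of the pure tensor `x ⊗ y` in `M ⊗_R N`. -/
def nctmk (R : Type*) [Ring R] {M N : Type*} [AddCommGroup M] [AddCommGroup N]
    [Module Rᵐᵒᵖ M] [Module R N] (x : M) (y : N) : NCTensor R M N :=
  Submodule.Quotient.mk (x ⊗ₜ[ℤ] y)

end

noncomputable section

open CategoryTheory CategoryTheory.Limits MulOpposite

variable {A : Type*} [Ring A]

lemma right_absorb'' {e : A} (he : IsIdempotentElem e) {x : A} (hx : e * x * e = x) :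
    x * e = x := by
  conv_lhs => rw [← hx]
  rw [mul_assoc, he]
  exact hx

/-- The restriction `Xe` of a right `A`-module `X` along an idempotent `e`. -/
def ResM (e : A) (X : Type*) [AddCommGroup X] [Module Aᵐᵒᵖ X] : Type _ :=
  {x : X // (op e : Aᵐᵒᵖ) • x = x}

namespace ResM

variable {e : A} {X : Type*} [AddCommGroup X] [Module Aᵐᵒᵖ X]

instance : Add (ResM e X) := ⟨fun x y => ⟨x.1 + y.1, by rw [smul_add, x.2, y.2]⟩⟩
instance : Zero (ResM e X) := ⟨⟨0, by simp⟩⟩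
instance : Neg (ResM e X) := ⟨fun x => ⟨-x.1, by rw [smul_neg, x.2]⟩⟩

instance addCommGroup : AddCommGroup (ResM e X) :=
  { add_assoc := fun x y z => Subtype.ext (add_assoc _ _ _)
    zero_add := fun x => Subtype.ext (zero_add _)
    add_zero := fun x => Subtype.ext (add_zero _)
    neg_add_cancel := fun x => Subtype.ext (neg_add_cancel _)
    add_comm := fun x y => Subtype.ext (add_comm _ _)
    nsmul := nsmulRec
    zsmul := zsmulRec }

/-- The right `eAe`-module structure on `Xe`. -/
instance module (he : IsIdempotentElem e) : Module (Corner e he)ᵐᵒᵖ (ResM e X) :=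
  { smul := fun r x => ⟨(op (unop r).1 : Aᵐᵒᵖ) • x.1, by
      calc (op e : Aᵐᵒᵖ) • ((op (unop r).1 : Aᵐᵒᵖ) • x.1)
          = ((op e : Aᵐᵒᵖ) * op (unop r).1) • x.1 := (mul_smul _ _ _).symm
        _ = (op ((unop r).1 * e) : Aᵐᵒᵖ) • x.1 := rfl
        _ = (op (unop r).1 : Aᵐᵒᵖ) • x.1 := by
            rw [right_absorb'' he (unop r).2]⟩
    one_smul := fun x => Subtype.ext x.2
    mul_smul := fun r s x => Subtype.ext (by
      show (op ((unop s).1 * (unop r).1) : Aᵐᵒᵖ) • x.1 =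
        (op (unop r).1 : Aᵐᵒᵖ) • ((op (unop s).1 : Aᵐᵒᵖ) • x.1)
      rw [← mul_smul]
      rfl)
    smul_zero := fun r => Subtype.ext (smul_zero _)
    smul_add := fun r x y => Subtype.ext (smul_add _ _ _)
    add_smul := fun r s x => Subtype.ext (by
      show (op ((unop r).1 + (unop s).1) : Aᵐᵒᵖ) • x.1 =
        (op (unop r).1 : Aᵐᵒᵖ) • x.1 + (op (unop s).1 : Aᵐᵒᵖ) • x.1
      rw [MulOpposite.op_add, add_smul])
    zero_smul := fun x => Subtype.ext (by
      show (op (0 : A) : Aᵐᵒᵖ) • x.1 = (0 : X)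
      simp) }

end ResM

/-- The injective dimension of a module `M` over a ring `S` is at most `n`:
`Ext^k(N, M) = 0` for all modules `N` and all `k > n`. -/
def injDimLE (S : Type) [Ring S] (M : ModuleCat S) (n : ℕ) : Prop :=
  ∀ (N : ModuleCat S) (k : ℕ), n < k →
    IsZero (((Ext ℤ (ModuleCat S) k).obj (Opposite.op N)).obj M)

namespace CategoryTheory

open Abelian

section

variable {C : Type*} [Category C] [Abelian C] [EnoughProjectives C]

/-- The `Ext`-functors obtained by deriving `Hom` and the `Ext`-groups defined through the
derived category vanish simultaneously in positive degrees. -/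
lemma isZero_Ext_succ_iff_subsingleton (R : Type*) [Ring R] [Linear R C] [HasExt C] (X Y : C)
    (n : ℕ) :
    IsZero (((_root_.Ext R C (n + 1)).obj (Opposite.op X)).obj Y) ↔
      Subsingleton (Abelian.Ext X Y (n + 1)) := by
  let P := projectiveResolution X
  have exact_iff : IsZero (((_root_.Ext R C (n + 1)).obj (Opposite.op X)).obj Y) ↔
      ∀ f : P.complex.X (n + 1) ⟶ Y, P.complex.d (n + 2) (n + 1) ≫ f = 0 →
        ∃ g : P.complex.X n ⟶ Y, P.complex.d (n + 1) n ≫ g = f := by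
    rw [(P.isoExt (n + 1) Y).isZero_iff, ← HomologicalComplex.exactAt_iff_isZero_homology,
      HomologicalComplex.exactAt_iff' _ n (n + 1) (n + 2) (by simp) (by simp),
      ShortComplex.moduleCat_exact_iff]
    rfl
  rw [exact_iff]
  constructor
  · refine fun h ↦ subsingleton_of_forall_eq 0 fun α ↦ ?_
    obtain ⟨f, hf, rfl⟩ := P.extMk_surjective α (n + 2) rfl
    exact (P.extMk_eq_zero_iff f (n + 2) rfl hf n rfl).2 (h f hf)
  · exact fun h f hf ↦ (P.extMk_eq_zero_iff f (n + 2) rfl hf n rfl).1 (Subsingleton.elim _ _)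

end

end CategoryTheory

namespace ModuleCat

open Abelian

variable {S : Type} [Ring S]

lemma hasInjectiveDimensionLE_of_ext_quotient_ideal (n : ℕ) (M : ModuleCat.{0} S)
    (h : ∀ I : Ideal S, Subsingleton (Abelian.Ext (ModuleCat.of S (S ⧸ I)) M (n + 1))) :
    HasInjectiveDimensionLE M n := by
  induction n generalizing M with
  | zero =>
    rw [HasInjectiveDimensionLE, zero_add, ← injective_iff_hasInjectiveDimensionLT_one]
    refine Module.injective_object_of_injective_module S M (inj := Module.Baer.injective ?_)
    intro I g
    let T : ShortComplex (ModuleCat.{0} S) :=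
      ModuleCat.shortComplexOfCompEqZero I.subtype I.mkQ (by ext; simp)
    have hT : T.ShortExact := ModuleCat.shortComplex_shortExact T
      (LinearMap.exact_subtype_mkQ I) I.injective_subtype I.mkQ_surjective
    obtain ⟨φ, hφ⟩ := Abelian.Ext.contravariant_sequence_exact₁ hT _
      (Abelian.Ext.mk₀ (ModuleCat.ofHom g : T.X₁ ⟶ M)) (add_zero 1)
      ((h I).elim _ _)
    obtain ⟨φ, rfl⟩ := Abelian.Ext.homEquiv₀.symm.surjective φ
    refine ⟨φ.hom, fun x hx ↦ ?_⟩
    have key : T.f ≫ φ = ModuleCat.ofHom g :=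
      Abelian.Ext.homEquiv₀.symm.injective (by simpa using hφ)
    exact congr($key ⟨x, hx⟩)
  | succ n ih =>
    let ⟨J, _, f, _⟩ := EnoughInjectives.presentation M
    have hT : (ShortComplex.mk _ _ (cokernel.condition f)).ShortExact :=
      { exact := ShortComplex.exact_cokernel f }
    refine (hT.hasInjectiveDimensionLT_X₃_iff n ‹_›).1 (ih _ fun I ↦ ?_)
    refine subsingleton_of_forall_eq 0 fun α ↦ ?_
    obtain ⟨β, rfl⟩ := Abelian.Ext.covariant_sequence_exact₃ _ hT α rfl ((h I).elim _ _)
    rw [Abelian.Ext.eq_zero_of_injective β, Abelian.Ext.zero_comp]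

lemma hasInjectiveDimensionLT_pi (M : ModuleCat.{0} S) (n : ℕ) [HasInjectiveDimensionLT M n]
    (m : ℕ) : HasInjectiveDimensionLT (ModuleCat.of S (Fin m → M)) n := by
  induction m with
  | zero =>
    have := (ModuleCat.isZero_of_subsingleton
      (ModuleCat.of S (Fin 0 → M))).hasInjectiveDimensionLT_zero
    exact hasInjectiveDimensionLT_of_ge _ 0 n n.zero_le
  | succ m ih =>
    exact hasInjectiveDimensionLT_of_iso ((ModuleCat.biprodIsoProd M (.of S (Fin m → M))).trans
      (Fin.consLinearEquiv S fun _ ↦ M).toModuleIso) n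

lemma hasInjectiveDimensionLT_of_finite_projective (n : ℕ)
    [HasInjectiveDimensionLT (ModuleCat.of S S) n] (M : Type) [AddCommGroup M] [Module S M]
    [Module.Finite S M] [Module.Projective S M] :
    HasInjectiveDimensionLT (ModuleCat.of S M) n := by
  obtain ⟨m, f, g, -, -, hfg⟩ := Module.Finite.exists_comp_eq_id_of_projective S M
  have := hasInjectiveDimensionLT_pi (ModuleCat.of S S) n m
  have retract : Retract (ModuleCat.of S M) (ModuleCat.of S (Fin m → S)) :=
    { i := ModuleCat.ofHom g
      r := ModuleCat.ofHom f
      retract := by rw [← ModuleCat.ofHom_comp, hfg]; rfl }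
  exact retract.hasInjectiveDimensionLT n

end ModuleCat

lemma injDimLE_iff_hasInjectiveDimensionLE (S : Type) [Ring S] (M : ModuleCat S) (n : ℕ) :
    injDimLE S M n ↔ HasInjectiveDimensionLE M n := by
  constructor
  · intro h
    exact hasInjectiveDimensionLT_of_enoughProjectives M (n + 1) fun N ↦
      (isZero_Ext_succ_iff_subsingleton ℤ N M n).1 (h N (n + 1) n.lt_succ_self)
  · intro h N k hk
    obtain ⟨k, rfl⟩ := Nat.exists_eq_succ_of_ne_zero (Nat.ne_zero_of_lt hk)
    exact (isZero_Ext_succ_iff_subsingleton ℤ N M k).2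
      (HasInjectiveDimensionLT.subsingleton M (n + 1) (k + 1) hk N)

/-- A ring is isomorphic to its opposite as a right module. -/
def MulOpposite.opRightLinearEquiv (R : Type*) [Ring R] : R ≃ₗ[Rᵐᵒᵖ] Rᵐᵒᵖ :=
  { MulOpposite.opAddEquiv with map_smul' := fun _ _ ↦ rfl }

/-- For `X = A`, the restriction `Xe` is the right `eAe`-module `Ae`. -/
def AeSub.equivResM {A : Type*} [Ring A] (e : A) (he : IsIdempotentElem e) :
    AeSub e ≃ₗ[(Corner e he)ᵐᵒᵖ] ResM e A where
  toFun x := ⟨x.1, x.2⟩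
  invFun x := ⟨x.1, x.2⟩
  map_add' _ _ := rfl
  map_smul' _ _ := rfl

lemma AeSub.finite (K : Type*) [Field K] {A : Type*} [Ring A] [Algebra K A]
    [FiniteDimensional K A] {e : A} (he : IsIdempotentElem e) :
    Module.Finite (Corner e he)ᵐᵒᵖ (AeSub e) := by
  let b := Module.finBasis K A
  let v : Fin (Module.finrank K A) → AeSub e := fun i ↦ ⟨b i * e, by rw [mul_assoc, he]⟩
  let val : AeSub e →+ A := { toFun := Subtype.val, map_zero' := rfl, map_add' := fun _ _ ↦ rfl }
  refine .of_surjective (Fintype.linearCombination (Corner e he)ᵐᵒᵖ v) fun x ↦ ?_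
  refine ⟨fun i ↦ op ⟨b.repr x.1 i • e, by simp [he.eq]⟩, Subtype.ext ?_⟩
  change val _ = _
  rw [Fintype.linearCombination_apply, map_sum]
  calc ∑ i, b i * e * (b.repr x.1 i • e) = (∑ i, b.repr x.1 i • b i) * e := by
        simp only [Finset.sum_mul, mul_smul_comm, smul_mul_assoc, mul_assoc, he.eq]
    _ = x.1 := by rw [b.sum_repr, x.2]

/-- Let `A` be a finite-dimensional algebra over a field `K`, `e` an idempotent and
`t ≥ 2`. Suppose that for all finite-dimensional right `A`-modules `X, Y` and all
`j > t` there are group isomorphisms `Ext^j_A(X, Y) ≅ Ext^j_{eAe}(Xe, Ye)`, and that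
`Ae` is projective as a right `eAe`-module. If `idim_{eAe} eAe ≤ n` for some `n ≥ t`,
then `idim_A A ≤ n`. (Right modules are formalised as left modules over the opposite
ring, and finite-dimensionality of a module over the finite-dimensional algebra `A` as
finite generation.) -/
theorem injdim_A_le (K : Type) [Field K] (A : Type) [Ring A] [Algebra K A]
    [FiniteDimensional K A] (e : A) (he : IsIdempotentElem e) (t n : ℕ)
    (ht : 2 ≤ t) (hn : t ≤ n)
    (hExt : ∀ (X Y : Type) [AddCommGroup X] [AddCommGroup Y]
      [Module Aᵐᵒᵖ X] [Module Aᵐᵒᵖ Y] [Module.Finite Aᵐᵒᵖ X] [Module.Finite Aᵐᵒᵖ Y]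
      (j : ℕ), t < j →
      Nonempty
        ((((Ext ℤ (ModuleCat Aᵐᵒᵖ) j).obj
            (Opposite.op (ModuleCat.of Aᵐᵒᵖ X))).obj (ModuleCat.of Aᵐᵒᵖ Y)) ≃+
         (((Ext ℤ (ModuleCat (Corner e he)ᵐᵒᵖ) j).obj
            (Opposite.op (ModuleCat.of (Corner e he)ᵐᵒᵖ (ResM e X)))).obj
            (ModuleCat.of (Corner e he)ᵐᵒᵖ (ResM e Y)))))
    (hproj : Module.Projective (Corner e he)ᵐᵒᵖ (AeSub e))
    (hself : injDimLE (Corner e he)ᵐᵒᵖ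
      (ModuleCat.of (Corner e he)ᵐᵒᵖ (Corner e he)) n) :
    injDimLE Aᵐᵒᵖ (ModuleCat.of Aᵐᵒᵖ A) n := by
  have := AeSub.finite K he
  have : Module.Finite Aᵐᵒᵖ A := .equiv (MulOpposite.opRightLinearEquiv A).symm
  rw [injDimLE_iff_hasInjectiveDimensionLE] at hself ⊢
  have : HasInjectiveDimensionLE
      (ModuleCat.of (Corner e he)ᵐᵒᵖ (Corner e he)ᵐᵒᵖ) n :=
    hasInjectiveDimensionLT_of_iso (MulOpposite.opRightLinearEquiv (Corner e he)).toModuleIso _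
  have := ModuleCat.hasInjectiveDimensionLT_of_finite_projective (S := (Corner e he)ᵐᵒᵖ)
    (n + 1) (AeSub e)
  have hres : injDimLE _ (ModuleCat.of (Corner e he)ᵐᵒᵖ (ResM e A)) n :=
    (injDimLE_iff_hasInjectiveDimensionLE _ _ _).2
      (hasInjectiveDimensionLT_of_iso (AeSub.equivResM e he).toModuleIso _)
  refine ModuleCat.hasInjectiveDimensionLE_of_ext_quotient_ideal n _ fun I ↦ ?_
  rw [← isZero_Ext_succ_iff_subsingleton ℤ]
  obtain ⟨φ⟩ := hExt (Aᵐᵒᵖ ⧸ I) A (n + 1) (Nat.lt_succ_of_le hn)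
  have := ModuleCat.subsingleton_of_isZero
    (hres (ModuleCat.of _ (ResM e (Aᵐᵒᵖ ⧸ I))) (n + 1) n.lt_succ_self)
  have := φ.subsingleton
  exact ModuleCat.isZero_of_subsingleton _

end
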